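/- For every integer q ≥ 2, the sequence II_n(Z_2, q) converges to a limit I(Z_2, q) satisfying I(Z_2, q) < 1/(q−1) − q^{−3} / ((1 − q^{−1})(1 − q^{−3})) + q^{−7} / ((1 − q^{−1})(1 − q^{−3})(1 − q^{−7})). -/

import Mathlib

/-- A word is a `Z₂`-instance if it has the form `ABA` with `A, B` nonempty. -/
def Z2Instance {α : Type*} (W : List α) : Prop :=
  ∃ A B : List α, A ≠ [] ∧ B ≠ [] ∧ W = A ++ B ++ A

/-- `instProb2 q n` is the probability that a uniformly random word of length `n`
over a `q`-letter alphabet is a `Z₂`-instance. -/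
noncomputable def instProb2 (q n : ℕ) : ℝ :=
  (Nat.card {W : List (Fin q) // W.length = n ∧ Z2Instance W} : ℝ) / (q : ℝ) ^ n

/-- `W = ABA` with `A` nonempty and `B` possibly empty. -/
def HasShortBorder {α : Type*} (W : List α) : Prop :=
  ∃ A B : List α, A ≠ [] ∧ W = A ++ B ++ A

/-- A nonempty word without a nonoverlapping border. -/
def Unbordered {α : Type*} (W : List α) : Prop :=
  W ≠ [] ∧ ¬ HasShortBorder W

theorem hasShortBorder_of_border {α : Type*} {W : List α} (C : List α) (hC : C ≠ [])
    (hlen : C.length < W.length) (hp : C <+: W) (hs : C <:+ W) : HasShortBorder W := by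
  induction hk : C.length using Nat.strong_induction_on generalizing C with
  | _ k ih =>
    by_cases h2 : 2 * C.length ≤ W.length
    · obtain ⟨X, hX⟩ := hp
      have hsX : C <:+ X := by
        refine List.suffix_of_suffix_length_le (l₃ := W) hs ⟨C, hX⟩ ?_
        have := congrArg List.length hX
        simp at this
        omega
      obtain ⟨B, rfl⟩ := hsX
      exact ⟨C, B, hC, by rw [← hX]; simp⟩
    · push Not at h2
      have e1 : C = W.take C.length := List.prefix_iff_eq_take.1 hp
      have e2 : C = W.drop (W.length - C.length) := List.suffix_iff_eq_drop.1 hs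
      have hD : C.drop (W.length - C.length) = C.take (2 * C.length - W.length) := by
        conv_lhs => rw [e1]
        conv_rhs => rw [e2]
        simp only [List.length_take, List.length_drop, List.drop_take]
        congr 1 <;> grind
      have hpos : 0 < C.length := List.length_pos_iff.2 hC
      refine ih _ ?_ (C.drop (W.length - C.length)) ?_ ?_ ?_ ?_ rfl
      · simp; omega
      · rw [← List.length_pos_iff]; simp; omega
      · simp; omega
      · rw [hD]; exact (List.take_prefix _ _).trans hp
      · exact (List.drop_suffix _ _).trans hs

theorem exists_unbordered {α : Type*} {W : List α} (A B : List α) (hA : A ≠ [])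
    (hW : W = A ++ B ++ A) :
    ∃ A' B' : List α, Unbordered A' ∧ B.length ≤ B'.length ∧ W = A' ++ B' ++ A' := by
  induction hk : A.length using Nat.strong_induction_on generalizing A B with
  | _ k ih =>
    by_cases h : HasShortBorder A
    · obtain ⟨C, D, hC, hA'⟩ := h
      have hpos : 0 < C.length := List.length_pos_iff.2 hC
      obtain ⟨A', B', h1, h2, h3⟩ := ih C.length (by rw [← hk, hA']; simp; omega) C
        (D ++ C ++ B ++ C ++ D) hC (by rw [hW, hA']; simp) rfl
      exact ⟨A', B', h1, le_trans (by simp; omega) h2, h3⟩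
    · exact ⟨A, B, ⟨hA, h⟩, le_rfl, hW⟩

theorem Unbordered.length_le {α : Type*} {A B A' B' : List α} (hA : Unbordered A)
    (hA' : Unbordered A') (h : A ++ B ++ A = A' ++ B' ++ A') : A'.length ≤ A.length := by
  by_contra! hlt
  refine hA'.2 (hasShortBorder_of_border A hA.1 hlt ?_ ?_)
  · refine List.prefix_of_prefix_length_le (l₃ := A ++ B ++ A) ⟨B ++ A, by simp⟩
      ⟨B' ++ A', by rw [h]; simp⟩ hlt.le
  · refine List.suffix_of_suffix_length_le (l₃ := A ++ B ++ A) ⟨A ++ B, by simp⟩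
      ⟨A' ++ B', by rw [h]⟩ hlt.le

open Classical in
/-- The words of length `n` over `q` letters satisfying `P`. -/
noncomputable def wordsWith (q n : ℕ) (P : List (Fin q) → Prop) : Finset (List (Fin q)) :=
  {W ∈ (List.finite_length_eq (Fin q) n).toFinset | P W}

theorem mem_wordsWith {q n : ℕ} {P : List (Fin q) → Prop} {W : List (Fin q)} :
    W ∈ wordsWith q n P ↔ W.length = n ∧ P W := by
  simp [wordsWith]

theorem card_wordsWith (q n : ℕ) (P : List (Fin q) → Prop) :
    (wordsWith q n P).card = Nat.card {W : List (Fin q) // W.length = n ∧ P W} := by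
  rw [← Nat.card_eq_finsetCard]
  exact Nat.card_congr (Equiv.subtypeEquivRight fun W => mem_wordsWith)

theorem card_wordsWith_true (q n : ℕ) : (wordsWith q n fun _ => True).card = q ^ n := by
  rw [card_wordsWith]
  simp only [and_true]
  have := card_vector (α := Fin q) n
  rw [← Nat.card_eq_fintype_card, Fintype.card_fin] at this
  exact this

/-- The number of unbordered words of length `l` over `q` letters. -/
noncomputable def unborderedCount (q l : ℕ) : ℕ := (wordsWith q l Unbordered).card

theorem unborderedCount_le (q l : ℕ) : unborderedCount q l ≤ q ^ l := by
  rw [← card_wordsWith_true]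
  refine Finset.card_le_card fun W hW => ?_
  rw [mem_wordsWith] at *
  exact ⟨hW.1, trivial⟩

theorem unborderedCount_zero (q : ℕ) : unborderedCount q 0 = 0 := by
  rw [unborderedCount, Finset.card_eq_zero, Finset.eq_empty_iff_forall_notMem]
  intro W hW
  obtain ⟨h, h'⟩ := mem_wordsWith.1 hW
  exact h'.1 (List.length_eq_zero_iff.1 h)

theorem card_words_sandwich (q n k : ℕ) :
    (wordsWith q n fun W => ∃ A B : List (Fin q), Unbordered A ∧ k ≤ B.length ∧
      W = A ++ B ++ A).card =
    ∑ l ∈ Finset.range (n + 1) with 2 * l + k ≤ n, unborderedCount q l * q ^ (n - 2 * l) := by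
  classical
  have hcard : ∀ l, unborderedCount q l * q ^ (n - 2 * l) =
      (wordsWith q l Unbordered ×ˢ wordsWith q (n - 2 * l) fun _ => True).card := fun l => by
    rw [Finset.card_product, card_wordsWith_true, unborderedCount]
  simp_rw [hcard]
  rw [← Finset.card_sigma]
  symm
  refine Finset.card_bij (fun x _ => x.2.1 ++ x.2.2 ++ x.2.1) ?_ ?_ ?_
  · rintro ⟨l, A, B⟩ h
    simp only [Finset.mem_sigma, Finset.mem_product, Finset.mem_filter, mem_wordsWith,
      Finset.mem_range] at h ⊢
    obtain ⟨⟨h1, h2⟩, ⟨h3, h4⟩, h5, -⟩ := h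
    exact ⟨by simp; omega, A, B, h4, by omega, rfl⟩
  · rintro ⟨l, A, B⟩ h ⟨l', A', B'⟩ h' heq
    simp only [Finset.mem_sigma, Finset.mem_product, Finset.mem_filter, mem_wordsWith,
      Finset.mem_range] at h h' heq
    obtain ⟨-, ⟨rfl, h4⟩, -, -⟩ := h
    obtain ⟨-, ⟨rfl, h4'⟩, -, -⟩ := h'
    have hl : A.length = A'.length := le_antisymm (h4'.length_le h4 heq.symm) (h4.length_le h4' heq)
    rw [List.append_assoc, List.append_assoc] at heq
    obtain ⟨rfl, h6⟩ := List.append_inj heq hl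
    obtain rfl := List.append_cancel_right h6
    rfl
  · intro W hW
    obtain ⟨hlen, A, B, hA, hB, rfl⟩ := mem_wordsWith.1 hW
    simp at hlen
    refine ⟨⟨A.length, A, B⟩, ?_, rfl⟩
    simp only [Finset.mem_sigma, Finset.mem_product, Finset.mem_filter, mem_wordsWith,
      Finset.mem_range]
    exact ⟨⟨by omega, by omega⟩, ⟨trivial, hA⟩, by omega, trivial⟩

theorem unborderedCount_add (q n : ℕ) (hn : n ≠ 0) :
    unborderedCount q n +
      ∑ l ∈ Finset.range (n / 2 + 1), unborderedCount q l * q ^ (n - 2 * l) = q ^ n := by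
  classical
  have hrange : Finset.range (n / 2 + 1) = {l ∈ Finset.range (n + 1) | 2 * l + 0 ≤ n} := by
    ext l; simp; omega
  rw [hrange, ← card_words_sandwich, ← card_wordsWith_true, unborderedCount,
    ← Finset.card_union_of_disjoint]
  · congr 1
    ext W
    simp only [Finset.mem_union, mem_wordsWith]
    constructor
    · rintro (⟨h, -⟩ | ⟨h, -⟩) <;> exact ⟨h, trivial⟩
    · rintro ⟨h, -⟩
      by_cases hS : HasShortBorder W
      · obtain ⟨A, B, hA, hW⟩ := hS
        obtain ⟨A', B', h1, -, h3⟩ := exists_unbordered A B hA hW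
        exact .inr ⟨h, A', B', h1, Nat.zero_le _, h3⟩
      · refine .inl ⟨h, ?_, hS⟩
        rintro rfl
        exact hn h.symm
  · rw [Finset.disjoint_left]
    intro W h h'
    obtain ⟨-, -, h⟩ := mem_wordsWith.1 h
    obtain ⟨-, A, B, hA, -, hW⟩ := mem_wordsWith.1 h'
    exact h ⟨A, B, hA.1, hW⟩

theorem unborderedCount_succ (q n : ℕ) :
    unborderedCount q (n + 1) + (if Even (n + 1) then unborderedCount q ((n + 1) / 2) else 0) =
      q * unborderedCount q n + if n = 0 then q else 0 := by
  have key : ∑ l ∈ Finset.range ((n + 1) / 2 + 1), unborderedCount q l * q ^ (n + 1 - 2 * l) =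
      q * ∑ l ∈ Finset.range (n / 2 + 1), unborderedCount q l * q ^ (n - 2 * l) +
        if Even (n + 1) then unborderedCount q ((n + 1) / 2) else 0 := by
    have hs : ∑ l ∈ Finset.range (n / 2 + 1), unborderedCount q l * q ^ (n + 1 - 2 * l) =
        q * ∑ l ∈ Finset.range (n / 2 + 1), unborderedCount q l * q ^ (n - 2 * l) := by
      rw [Finset.mul_sum]
      refine Finset.sum_congr rfl fun l hl => ?_
      rw [Finset.mem_range] at hl
      rw [show n + 1 - 2 * l = n - 2 * l + 1 by omega, pow_succ]
      ring
    split_ifs with h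
    · have h2 : (n + 1) / 2 = n / 2 + 1 := by grind
      rw [h2, Finset.sum_range_succ, hs, show n + 1 - 2 * (n / 2 + 1) = 0 by grind]
      simp
    · have h2 : (n + 1) / 2 = n / 2 := by grind
      rw [h2, hs, add_zero]
  have h1 := unborderedCount_add q (n + 1) n.succ_ne_zero
  rw [key] at h1
  rcases eq_or_ne n 0 with rfl | hn
  · simpa [unborderedCount_zero] using h1
  · have h0 := unborderedCount_add q n hn
    rw [pow_succ, ← h0] at h1
    simp only [hn, if_false]
    linarith

/-- The generating function of unbordered words. -/
noncomputable def unborderedGF (q : ℕ) (x : ℝ) : ℝ := ∑' l, (unborderedCount q l : ℝ) * x ^ l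

theorem summable_unbordered {q : ℕ} {x : ℝ} (hx : 0 ≤ x) (hqx : q * x < 1) :
    Summable fun l => (unborderedCount q l : ℝ) * x ^ l := by
  refine Summable.of_nonneg_of_le (fun l => by positivity) (fun l => ?_)
    (summable_geometric_of_lt_one (by positivity) hqx)
  rw [mul_pow]
  gcongr
  exact_mod_cast unborderedCount_le q l

theorem unborderedGF_pos {q : ℕ} (hq : 0 < q) {x : ℝ} (hx : 0 < x) (hqx : q * x < 1) :
    0 < unborderedGF q x := by
  refine (summable_unbordered hx.le hqx).tsum_pos (fun l => by positivity) 1 ?_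
  have := unborderedCount_succ q 0
  simp [unborderedCount_zero] at this
  rw [this]
  positivity

theorem unborderedGF_eq {q : ℕ} {x : ℝ} (hx : 0 ≤ x) (hx1 : x ≤ 1) (hqx : q * x < 1) :
    (1 - q * x) * unborderedGF q x = q * x - unborderedGF q (x ^ 2) := by
  have hqx2 : (q : ℝ) * x ^ 2 < 1 := by
    refine lt_of_le_of_lt ?_ hqx
    gcongr
    nlinarith
  have hV := (summable_unbordered hx hqx).hasSum
  have hV2 := (summable_unbordered (sq_nonneg x) hqx2).hasSum
  change HasSum _ (unborderedGF q x) at hV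
  change HasSum _ (unborderedGF q (x ^ 2)) at hV2
  have heven : HasSum (fun n => if Even n then (unborderedCount q (n / 2) : ℝ) * x ^ n else 0)
      (unborderedGF q (x ^ 2)) := by
    have hinj : Function.Injective fun l : ℕ => 2 * l := fun a b h => by simpa using h
    rw [← hinj.hasSum_iff]
    · simpa [Function.comp_def, pow_mul] using hV2
    · intro n hn
      rw [if_neg]
      rintro ⟨m, rfl⟩
      exact hn ⟨m, by simp; ring⟩
  have h1 := (hasSum_nat_add_iff' 1).2 hV
  have h2 := (hasSum_nat_add_iff' 1).2 heven
  have h3 := hV.mul_left (q * x)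
  have h4 := hasSum_ite_eq (0 : ℕ) ((q : ℝ) * x)
  have hfun : ∀ n : ℕ, (unborderedCount q (n + 1) : ℝ) * x ^ (n + 1) +
      (if Even (n + 1) then (unborderedCount q ((n + 1) / 2) : ℝ) * x ^ (n + 1) else 0) =
      q * x * (unborderedCount q n * x ^ n) + if n = 0 then q * x else 0 := fun n => by
    have := congrArg (Nat.cast (R := ℝ)) (unborderedCount_succ q n)
    push_cast at this
    rcases eq_or_ne n 0 with rfl | hn
    · simpa [unborderedCount_zero] using congrArg (· * x) this
    · simp only [hn, if_false, add_zero] at this ⊢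
      split_ifs at this ⊢ <;> linear_combination x ^ (n + 1) * this
  have h5 := (h1.add h2).unique ((funext hfun) ▸ h3.add h4)
  simp [unborderedCount_zero] at h5
  linarith

theorem instProb2_eq {q : ℕ} (hq : q ≠ 0) (n : ℕ) :
    instProb2 q n =
      ∑ l ∈ Finset.range ((n + 1) / 2), (unborderedCount q l : ℝ) * ((q : ℝ)⁻¹ ^ 2) ^ l := by
  have hZ : ∀ W : List (Fin q), Z2Instance W ↔
      ∃ A B : List (Fin q), Unbordered A ∧ 1 ≤ B.length ∧ W = A ++ B ++ A := fun W => by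
    constructor
    · rintro ⟨A, B, hA, hB, hW⟩
      obtain ⟨A', B', h1, h2, h3⟩ := exists_unbordered A B hA hW
      exact ⟨A', B', h1, (List.length_pos_iff.2 hB).trans_le h2, h3⟩
    · rintro ⟨A, B, hA, hB, hW⟩
      exact ⟨A, B, hA.1, List.length_pos_iff.1 hB, hW⟩
  have hrange : {l ∈ Finset.range (n + 1) | 2 * l + 1 ≤ n} = Finset.range ((n + 1) / 2) := by
    ext l; simp; omega
  have hq' : (q : ℝ) ≠ 0 := by exact_mod_cast hq
  simp only [instProb2, hZ]
  rw [← card_wordsWith, card_words_sandwich, hrange]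
  push_cast
  rw [Finset.sum_div]
  refine Finset.sum_congr rfl fun l hl => ?_
  rw [Finset.mem_range] at hl
  rw [mul_div_assoc, ← pow_mul, inv_pow, pow_sub₀ _ hq' (by omega)]
  field_simp

theorem tendsto_instProb2 {q : ℕ} (hq : 2 ≤ q) :
    Filter.Tendsto (fun n => instProb2 q n) Filter.atTop
      (nhds (unborderedGF q ((q : ℝ)⁻¹ ^ 2))) := by
  have hq' : (2 : ℝ) ≤ q := by exact_mod_cast hq
  have hlt : (q : ℝ) * (q : ℝ)⁻¹ ^ 2 < 1 := by
    rw [pow_two, ← mul_assoc, mul_inv_cancel₀ (by positivity), one_mul]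
    exact inv_lt_one_of_one_lt₀ (by linarith)
  simp_rw [instProb2_eq (show q ≠ 0 by omega)]
  refine (summable_unbordered (by positivity) hlt).hasSum.tendsto_sum_nat.comp ?_
  refine Filter.tendsto_atTop_mono (f := fun n => n / 2) (fun n => by grind) ?_
  exact Nat.tendsto_div_const_atTop (by norm_num)

/-- For `q ≥ 2`, `instProb2 q n` converges to a limit `I` with
`I < 1/(q−1) − q^{−3}/((1−q^{−1})(1−q^{−3})) + q^{−7}/((1−q^{−1})(1−q^{−3})(1−q^{−7}))`. -/
theorem instProb2_limit_upper (q : ℕ) (hq : 2 ≤ q) :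
    ∃ I : ℝ, Filter.Tendsto (fun n => instProb2 q n) Filter.atTop (nhds I) ∧
      I < 1 / ((q : ℝ) - 1) -
        (q : ℝ) ^ (-3 : ℤ) / ((1 - (q : ℝ) ^ (-1 : ℤ)) * (1 - (q : ℝ) ^ (-3 : ℤ))) +
        (q : ℝ) ^ (-7 : ℤ) /
          ((1 - (q : ℝ) ^ (-1 : ℤ)) * (1 - (q : ℝ) ^ (-3 : ℤ)) * (1 - (q : ℝ) ^ (-7 : ℤ))) := by
  refine ⟨_, tendsto_instProb2 hq, ?_⟩
  have hq' : (2 : ℝ) ≤ q := by exact_mod_cast hq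
  set t : ℝ := (q : ℝ)⁻¹ with ht
  have ht0 : 0 < t := by positivity
  have hqt : (q : ℝ) * t = 1 := mul_inv_cancel₀ (by positivity)
  have ht1 : t < 1 := inv_lt_one_of_one_lt₀ (by linarith)
  have hpow : ∀ k : ℕ, k ≠ 0 → t ^ k < 1 := fun k hk => pow_lt_one₀ ht0.le ht1 hk
  have hmul : ∀ k : ℕ, (q : ℝ) * t ^ (k + 1) = t ^ k := fun k => by
    rw [pow_succ', ← mul_assoc, hqt, one_mul]
  have step : ∀ k : ℕ, k ≠ 0 → (1 - t ^ k) * unborderedGF q (t ^ (k + 1)) =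
      t ^ k - unborderedGF q (t ^ ((k + 1) * 2)) := fun k hk => by
    have := unborderedGF_eq (q := q) (x := t ^ (k + 1)) (by positivity)
      (hpow _ k.succ_ne_zero).le (by rw [hmul]; exact hpow k hk)
    rwa [hmul, ← pow_mul] at this
  have e1 := step 1 (by norm_num)
  have e2 := step 3 (by norm_num)
  have e3 := step 7 (by norm_num)
  have hpos : 0 < unborderedGF q (t ^ 16) :=
    unborderedGF_pos (by omega) (by positivity) (by rw [hmul 15]; exact hpow 15 (by norm_num))
  norm_num at e1 e2 e3
  have d1 : 0 < 1 - t := by linarith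
  have d3 : 0 < 1 - t ^ 3 := by linarith [hpow 3 (by norm_num)]
  have d7 : 0 < 1 - t ^ 7 := by linarith [hpow 7 (by norm_num)]
  have z : ∀ k : ℕ, (q : ℝ) ^ (-(k : ℤ)) = t ^ k := fun k => by
    rw [zpow_neg, zpow_natCast, ht, inv_pow]
  have z1 := z 1
  have z3 := z 3
  have z7 := z 7
  norm_num only [Nat.cast_ofNat, Nat.cast_one, pow_one] at z1 z3 z7
  rw [z1, z3, z7]
  have hq1 : 1 / ((q : ℝ) - 1) = t / (1 - t) := by
    rw [div_eq_div_iff (by linarith) d1.ne']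
    linear_combination -hqt
  have v8 : unborderedGF q (t ^ 8) < t ^ 7 / (1 - t ^ 7) := by
    rw [lt_div_iff₀ d7]
    linarith
  have v2 : unborderedGF q (t ^ 2) = t / (1 - t) - t ^ 3 / ((1 - t) * (1 - t ^ 3)) +
      unborderedGF q (t ^ 8) / ((1 - t) * (1 - t ^ 3)) := by
    field_simp
    linear_combination (1 - t ^ 3) * e1 - e2
  rw [hq1, v2, mul_comm _ (1 - t ^ 7), ← div_div (t ^ 7)]
  gcongr
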